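/- Fix d ∈ ℕ with d ≥ 1 and adopt all the hypotheses and definitions of the previous setting: for each pair w = (a, b) of sequences a, b : ℤ → ℝ with a n > 0, Jacobi operator J(w), entries μ(w) t := ((J(w))^t δ₁) 1, ν(w) t := ((J(w))^t δ₂) 1, shift S(a, b) := (n ↦ a (n+1), n ↦ b (n+1)) with inverse S⁻¹(a, b) = (n ↦ a (n-1), n ↦ b (n-1)), coefficient functions A, C, D satisfying hypotheses (i)-(v), and p, q defined by the recursions p d w = C (d-1) w / 2, p r w = C (r-1) w / 2 - ∑_{s=r+1}^{d} p s w * μ(w) (s - r); q d w = -A d w + C (d-1) w, q (d-1) w = -A (d-1) w + C (d-2) w - b₁ * C (d-1) w, q r w = -2 * a₁ * ∑_{s=r+2}^{d} ν(w) (s - r - 1) * q s w - A r w + C (r-1) w - b₁ * C r w for 1 ≤ r ≤ d - 2. Assume additionally that for every w: (vi) 2 * A 0 w = -b₁ * C 0 w - a₁^2 * C 1 (S w) + a₀^2 * C 1 (S⁻¹ w) - b₁ * (A 1 (S w) - A 1 w), where a₀ = a 0. Then for every w: A 0 w + b₁ * C 0 w + 2 * a₁ * ∑_{j=1}^{d-1}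 ν(w) j * q (j+1) w - ∑_{j=1}^{d} μ(w) j * q j w = 0. -/

import Mathlib

theorem aux_left (J : (ℤ → ℂ) →ₗ[ℂ] (ℤ → ℂ)) (a b : ℤ → ℝ)
    (hJ : ∀ (u : ℤ → ℂ) (n : ℤ),
      J u n = (a n : ℂ) * u (n + 1) + (a (n - 1) : ℂ) * u (n - 1) + (b n : ℂ) * u n)
    (i j : ℤ) (t : ℕ) :
    (J ^ (t+1)) (Pi.single j 1) i = (a i : ℂ) * (J ^ t) (Pi.single j 1) (i+1)
      + (a (i-1) : ℂ) * (J ^ t) (Pi.single j 1) (i-1) + (b i : ℂ) * (J ^ t) (Pi.single j 1) i := by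
  rw [pow_succ', Module.End.mul_apply, hJ]

theorem aux_right (J : (ℤ → ℂ) →ₗ[ℂ] (ℤ → ℂ)) (a b : ℤ → ℝ)
    (hJ : ∀ (u : ℤ → ℂ) (n : ℤ),
      J u n = (a n : ℂ) * u (n + 1) + (a (n - 1) : ℂ) * u (n - 1) + (b n : ℂ) * u n)
    (i j : ℤ) (t : ℕ) :
    (J ^ (t+1)) (Pi.single j 1) i = (a j : ℂ) * (J ^ t) (Pi.single (j+1) 1) i
      + (a (j-1) : ℂ) * (J ^ t) (Pi.single (j-1) 1) i + (b j : ℂ) * (J ^ t) (Pi.single j 1) i := by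
  have h : J (Pi.single j 1) = (a j : ℂ) • (Pi.single (j+1) 1 : ℤ → ℂ)
      + (a (j-1) : ℂ) • (Pi.single (j-1) 1 : ℤ → ℂ) + (b j : ℂ) • (Pi.single j 1 : ℤ → ℂ) := by
    funext n
    rw [hJ]
    simp only [Pi.add_apply, Pi.smul_apply, smul_eq_mul, Pi.single_apply]
    by_cases h1 : n = j
    · subst h1
      have e1 : ¬ (n = n - 1) := by omega
      simp [e1]
    · by_cases h2 : n = j + 1
      · subst h2
        have e1 : ¬ (j + 1 + 1 = j) := by omega
        have e2 : ¬ (j + 1 = j - 1) := by omega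
        simp [e1, e2]
      · by_cases h3 : n = j - 1
        · subst h3
          have e1 : ¬ (j - 1 - 1 = j) := by omega
          have e2 : ¬ (j - 1 = j + 1) := by omega
          simp [e1, e2]
        · have e1 : ¬ (n + 1 = j) := by omega
          have e2 : ¬ (n - 1 = j) := by omega
          simp [e1, e2, h1, h2, h3]
  rw [pow_succ, Module.End.mul_apply, h]
  simp

theorem aux_symm (J : (ℤ → ℂ) →ₗ[ℂ] (ℤ → ℂ)) (a b : ℤ → ℝ)
    (hJ : ∀ (u : ℤ → ℂ) (n : ℤ),
      J u n = (a n : ℂ) * u (n + 1) + (a (n - 1) : ℂ) * u (n - 1) + (b n : ℂ) * u n)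
    (t : ℕ) : ∀ (i j : ℤ), (J ^ t) (Pi.single j 1) i = (J ^ t) (Pi.single i 1) j := by
  induction t with
  | zero => intro i j; simp [Pi.single_apply, eq_comm]
  | succ t ih =>
    intro i j
    rw [aux_left J a b hJ, aux_right J a b hJ, ih (i+1), ih (i-1), ih i]

theorem aux_shift (J J' : (ℤ → ℂ) →ₗ[ℂ] (ℤ → ℂ)) (a b : ℤ → ℝ)
    (hJ : ∀ (u : ℤ → ℂ) (n : ℤ),
      J u n = (a n : ℂ) * u (n + 1) + (a (n - 1) : ℂ) * u (n - 1) + (b n : ℂ) * u n)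
    (hJ' : ∀ (u : ℤ → ℂ) (n : ℤ),
      J' u n = (a (n+1) : ℂ) * u (n + 1) + (a (n - 1 + 1) : ℂ) * u (n - 1) + (b (n+1) : ℂ) * u n)
    (j : ℤ) (t : ℕ) :
    ∀ i : ℤ, (J' ^ t) (Pi.single j 1) i = (J ^ t) (Pi.single (j+1) 1) (i+1) := by
  induction t with
  | zero => intro i; simp [Pi.single_apply]
  | succ t ih =>
    intro i
    rw [aux_left J a b hJ,
      aux_left J' (fun n => a (n+1)) (fun n => b (n+1)) hJ', ih, ih, ih]
    rw [show i - 1 + 1 = i + 1 - 1 by ring]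

theorem aux_Icc (a d : ℕ) (f : ℕ → ℂ) :
    ∑ s ∈ Finset.Icc a d, f s = ∑ k ∈ Finset.range (d + 1 - a), f (a + k) := by
  rw [← Finset.sum_Ico_eq_sum_range]
  congr 1

theorem aux_core (v vm mp mm e : ℕ → ℂ) (a1 a0 b : ℂ) (h1 : v 0 = 0) (h2 : vm 0 = 0)
    (h : ∀ t, a1 * v (t+1) - a0 * vm (t+1) = b * (a1 * v t - a0 * vm t)
      + a1 ^ 2 * mp t - a0 ^ 2 * mm t) (d r : ℕ) :
    a1 * ∑ k ∈ Finset.range (d - r), v k * e (r+1+k)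
      - a0 * ∑ k ∈ Finset.range (d - r), vm k * e (r+1+k)
    = b * (a1 * ∑ k ∈ Finset.range (d - (r+1)), v k * e (r+1+1+k)
      - a0 * ∑ k ∈ Finset.range (d - (r+1)), vm k * e (r+1+1+k))
      + a1 ^ 2 * ∑ k ∈ Finset.range (d - (r+1)), e (r+1+1+k) * mp k
      - a0 ^ 2 * ∑ k ∈ Finset.range (d - (r+1)), e (r+1+1+k) * mm k := by
  rcases Nat.lt_or_ge r d with hr | hr
  · obtain ⟨n, rfl⟩ : ∃ n, d = r + 1 + n := ⟨d - (r+1), by omega⟩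
    rw [show r + 1 + n - r = n + 1 by omega, show r + 1 + n - (r+1) = n by omega,
      Finset.sum_range_succ', Finset.sum_range_succ', h1, h2]
    simp only [zero_mul, add_zero, Finset.mul_sum, ← Finset.sum_sub_distrib,
      ← Finset.sum_add_distrib]
    refine Finset.sum_congr rfl fun k _ => ?_
    rw [show r + 1 + (k+1) = r + 1 + 1 + k by ring]
    linear_combination (e (r+1+1+k)) * h k
  · rw [show d - r = 0 by omega, show d - (r+1) = 0 by omega]; simp

theorem aux_core2 (m v vm e : ℕ → ℂ) (a1 a0 b : ℂ) (n r : ℕ)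
    (h : ∀ t, m (t+1) = a1 * v t + a0 * vm t + b * m t) :
    ∑ k ∈ Finset.range n, e (r+1+k) * m (k+1)
    = a1 * ∑ k ∈ Finset.range n, v k * e (r+1+k) + a0 * ∑ k ∈ Finset.range n, vm k * e (r+1+k)
      + b * ∑ k ∈ Finset.range n, e (r+1+k) * m k := by
  simp only [Finset.mul_sum, ← Finset.sum_add_distrib]
  refine Finset.sum_congr rfl fun k _ => ?_
  rw [h]; ring

theorem prop_unfinished_constant_terms_vanish
    (d : ℕ) (hd : 1 ≤ d)
    (Jop : ((ℤ → ℝ) × (ℤ → ℝ)) → ((ℤ → ℂ) →ₗ[ℂ] (ℤ → ℂ)))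
    (hJ : ∀ (w : (ℤ → ℝ) × (ℤ → ℝ)) (u : ℤ → ℂ) (n : ℤ),
      Jop w u n = (w.1 n : ℂ) * u (n + 1) + (w.1 (n - 1) : ℂ) * u (n - 1) + (w.2 n : ℂ) * u n)
    (S : ((ℤ → ℝ) × (ℤ → ℝ)) → ((ℤ → ℝ) × (ℤ → ℝ)))
    (hS : ∀ w : (ℤ → ℝ) × (ℤ → ℝ), S w = (fun n => w.1 (n + 1), fun n => w.2 (n + 1)))
    (μ ν : ((ℤ → ℝ) × (ℤ → ℝ)) → ℕ → ℂ)
    (hμ : ∀ (w : (ℤ → ℝ) × (ℤ → ℝ)) (t : ℕ), μ w t = ((Jop w ^ t) (Pi.single 1 1)) 1)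
    (hν : ∀ (w : (ℤ → ℝ) × (ℤ → ℝ)) (t : ℕ), ν w t = ((Jop w ^ t) (Pi.single 2 1)) 1)
    (A C D : ℕ → ((ℤ → ℝ) × (ℤ → ℝ)) → ℂ)
    (p q : ℕ → ((ℤ → ℝ) × (ℤ → ℝ)) → ℂ)
    (hi : ∀ w : (ℤ → ℝ) × (ℤ → ℝ), (∀ n, 0 < w.1 n) →
      ∀ j ≤ d, D j (S w) = -(w.1 1 : ℂ) ^ 2 * C j w)
    (hii : ∀ w : (ℤ → ℝ) × (ℤ → ℝ), (∀ n, 0 < w.1 n) → C d w = 0)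
    (hiii : ∀ w : (ℤ → ℝ) × (ℤ → ℝ), (∀ n, 0 < w.1 n) → ∀ j, 1 ≤ j → j ≤ d →
      A j (S w) + A j w = C (j - 1) w - (w.2 1 : ℂ) * C j w)
    (hiv : ∀ w : (ℤ → ℝ) × (ℤ → ℝ), (∀ n, 0 < w.1 n) → A d (S w) = A d w)
    (hv : ∀ w : (ℤ → ℝ) × (ℤ → ℝ), (∀ n, 0 < w.1 n) → ∀ j, 2 ≤ j → j ≤ d →
      -(w.2 1 : ℂ) * (A j (S w) - A j w) + (A (j - 1) (S w) - A (j - 1) w)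
        = (w.1 1 : ℂ) ^ 2 * C j (S w) + D j w)
    (hpd : ∀ w : (ℤ → ℝ) × (ℤ → ℝ), (∀ n, 0 < w.1 n) → p d w = C (d - 1) w / 2)
    (hpr : ∀ w : (ℤ → ℝ) × (ℤ → ℝ), (∀ n, 0 < w.1 n) → ∀ r, 1 ≤ r → r ≤ d →
      p r w = C (r - 1) w / 2 - ∑ s ∈ Finset.Icc (r + 1) d, p s w * μ w (s - r))
    (hqd : ∀ w : (ℤ → ℝ) × (ℤ → ℝ), (∀ n, 0 < w.1 n) → q d w = -A d w + C (d - 1) w)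
    (hqd1 : ∀ w : (ℤ → ℝ) × (ℤ → ℝ), (∀ n, 0 < w.1 n) →
      q (d - 1) w = -A (d - 1) w + C (d - 2) w - (w.2 1 : ℂ) * C (d - 1) w)
    (hqr : ∀ w : (ℤ → ℝ) × (ℤ → ℝ), (∀ n, 0 < w.1 n) → ∀ r, 1 ≤ r → r ≤ d - 2 →
      q r w = -2 * (w.1 1 : ℂ) * ∑ s ∈ Finset.Icc (r + 2) d, ν w (s - r - 1) * q s w
        - A r w + C (r - 1) w - (w.2 1 : ℂ) * C r w)
    (Sinv : ((ℤ → ℝ) × (ℤ → ℝ)) → ((ℤ → ℝ) × (ℤ → ℝ)))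
    (hSinv : ∀ w : (ℤ → ℝ) × (ℤ → ℝ), Sinv w = (fun n => w.1 (n - 1), fun n => w.2 (n - 1)))
    (hvi : ∀ w : (ℤ → ℝ) × (ℤ → ℝ), (∀ n, 0 < w.1 n) →
      2 * A 0 w = -(w.2 1 : ℂ) * C 0 w - (w.1 1 : ℂ) ^ 2 * C 1 (S w)
        + (w.1 0 : ℂ) ^ 2 * C 1 (Sinv w) - (w.2 1 : ℂ) * (A 1 (S w) - A 1 w)) :
    ∀ w : (ℤ → ℝ) × (ℤ → ℝ), (∀ n, 0 < w.1 n) →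
      A 0 w + (w.2 1 : ℂ) * C 0 w
        + 2 * (w.1 1 : ℂ) * ∑ j ∈ Finset.Icc 1 (d - 1), ν w j * q (j + 1) w
        - ∑ j ∈ Finset.Icc 1 d, μ w j * q j w = 0 := by
  have hSSinv : ∀ w, S (Sinv w) = w := by
    intro w; rw [hS, hSinv]; ext n <;> simp
  have hpos : ∀ w : (ℤ → ℝ) × (ℤ → ℝ), (∀ n, 0 < w.1 n) → ∀ n, 0 < (Sinv w).1 n := by
    intro w hw n; rw [hSinv]; exact hw _
  have hposS : ∀ w : (ℤ → ℝ) × (ℤ → ℝ), (∀ n, 0 < w.1 n) → ∀ n, 0 < (S w).1 n := by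
    intro w hw n; rw [hS]; exact hw _
  have hSinvS : ∀ w, Sinv (S w) = w := by
    intro w; rw [hS, hSinv]; ext n <;> simp
  have hainv : ∀ w, (Sinv w).1 1 = w.1 0 := by
    intro w; rw [hSinv]; simp
  have shS : ∀ w j t i, (Jop (S w) ^ t) (Pi.single j 1) i
      = (Jop w ^ t) (Pi.single (j+1) 1) (i+1) := by
    intro w j t i
    refine aux_shift (Jop w) (Jop (S w)) w.1 w.2 (hJ w) ?_ j t i
    intro u n; rw [hJ, hS]
  have shI : ∀ w j t i, (Jop (Sinv w) ^ t) (Pi.single (j+1) 1) (i+1)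
      = (Jop w ^ t) (Pi.single j 1) i := by
    intro w j t i
    rw [← shS, hSSinv]
  have μp : ∀ w t, μ (S w) t = (Jop w ^ t) (Pi.single 2 1) 2 := by
    intro w t; rw [hμ, shS]; rfl
  have μm : ∀ w t, μ (Sinv w) t = (Jop w ^ t) (Pi.single 0 1) 0 := by
    intro w t; rw [hμ]; exact shI w 0 t 0
  have νm : ∀ w t, ν (Sinv w) t = (Jop w ^ t) (Pi.single 1 1) 0 := by
    intro w t; rw [hν]; exact shI w 1 t 0
  have μ0 : ∀ w, μ w 0 = 1 := by intro w; rw [hμ]; simp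
  have ν0 : ∀ w, ν w 0 = 0 := by intro w; rw [hν]; simp [Pi.single_apply]
  have hμrec : ∀ w t, μ w (t+1) = (w.1 1 : ℂ) * ν w t + (w.1 0 : ℂ) * ν (Sinv w) t
      + (w.2 1 : ℂ) * μ w t := by
    intro w t
    rw [hμ, hν, νm, hμ, aux_right (Jop w) w.1 w.2 (hJ w),
      aux_symm (Jop w) w.1 w.2 (hJ w) t 0 1]
    norm_num
  have hνrec : ∀ w t, (w.1 1 : ℂ) * ν w (t+1) - (w.1 0 : ℂ) * ν (Sinv w) (t+1)
      = (w.2 1 : ℂ) * ((w.1 1 : ℂ) * ν w t - (w.1 0 : ℂ) * ν (Sinv w) t)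
      + (w.1 1 : ℂ) ^ 2 * μ (S w) t - (w.1 0 : ℂ) ^ 2 * μ (Sinv w) t := by
    intro w t
    rw [νm, νm, μp, μm, hν, hν, aux_left (Jop w) w.1 w.2 (hJ w) 1 2,
      aux_right (Jop w) w.1 w.2 (hJ w) 0 1]
    norm_num
    ring
  have hD : ∀ w : (ℤ → ℝ) × (ℤ → ℝ), (∀ n, 0 < w.1 n) → ∀ j ≤ d,
      D j w = -(w.1 0 : ℂ) ^ 2 * C j (Sinv w) := by
    intro w hw j hj
    have := hi (Sinv w) (hpos w hw) j hj
    rwa [hSSinv, hainv] at this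
  have hC : ∀ w : (ℤ → ℝ) × (ℤ → ℝ), (∀ n, 0 < w.1 n) → ∀ r < d,
      C r w = 2 * p (r+1) w + 2 * ∑ k ∈ Finset.range (d - (r+1)), p (r+1+1+k) w * μ w (k+1) := by
    intro w hw r hr
    have := hpr w hw (r+1) (by omega) (by omega)
    rw [aux_Icc, show d + 1 - (r + 1 + 1) = d - (r+1) by omega] at this
    have e : ∑ k ∈ Finset.range (d - (r+1)), p (r+1+1+k) w * μ w (r+1+1+k - (r+1))
        = ∑ k ∈ Finset.range (d - (r+1)), p (r+1+1+k) w * μ w (k+1) :=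
      Finset.sum_congr rfl fun k _ => by rw [show r+1+1+k - (r+1) = k + 1 by omega]
    rw [e, Nat.add_sub_cancel] at this
    rw [this]; ring
  have hC2 : ∀ w : (ℤ → ℝ) × (ℤ → ℝ), (∀ n, 0 < w.1 n) → ∀ r ≤ d,
      C r w = 2 * ∑ k ∈ Finset.range (d - r), p (r+1+k) w * μ w k := by
    intro w hw r hr
    rcases hr.lt_or_eq with h | h
    · rw [hC w hw r h, show d - r = d - (r+1) + 1 by omega, Finset.sum_range_succ', μ0]
      have e : ∑ k ∈ Finset.range (d - (r+1)), p (r+1+1+k) w * μ w (k+1)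
        = ∑ k ∈ Finset.range (d - (r+1)), p (r+1+(k+1)) w * μ w (k+1) :=
        Finset.sum_congr rfl fun k _ => by rw [show r+1+1+k = r+1+(k+1) by omega]
      rw [e]; ring_nf
    · subst h; simp [hii w hw]
  have hA : ∀ w : (ℤ → ℝ) × (ℤ → ℝ), (∀ n, 0 < w.1 n) → ∀ r, 1 ≤ r → r ≤ d →
      A r (S w) = q r w + 2 * (w.1 1 : ℂ) * ∑ k ∈ Finset.range (d - r), ν w k * q (r+1+k) w := by
    intro w hw r h1 h2
    have h3 := hiii w hw r h1 h2
    by_cases hd1 : r = d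
    · subst hd1
      simp only [Nat.sub_self, Finset.range_zero, Finset.sum_empty, mul_zero, add_zero]
      rw [hqd w hw]
      rw [hii w hw] at h3
      linear_combination h3
    · by_cases hd2 : r = d - 1
      · have h4 := hqd1 w hw
        rw [show d - 2 = r - 1 by omega, ← hd2] at h4
        rw [show d - r = 1 by omega, h4]
        simp only [Finset.sum_range_one, ν0]
        linear_combination h3
      · have h4 := hqr w hw r h1 (by omega)
        rw [aux_Icc, show d + 1 - (r+2) = d - (r + 1) by omega] at h4
        rw [show d - r = d - (r+1) + 1 by omega, Finset.sum_range_succ', ν0, h4]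
        have e : ∑ k ∈ Finset.range (d - (r+1)), ν w (r + 2 + k - r - 1) * q (r+2+k) w
          = ∑ k ∈ Finset.range (d - (r+1)), ν w (k+1) * q (r+1+(k+1)) w :=
          Finset.sum_congr rfl fun k _ => by
            rw [show r+2+k = r+1+(k+1) by omega, show r + 1 + (k+1) - r - 1 = k + 1 by omega]
        rw [e]
        linear_combination h3
  have hA' : ∀ w : (ℤ → ℝ) × (ℤ → ℝ), (∀ n, 0 < w.1 n) → ∀ r, 1 ≤ r → r ≤ d →
      A r w = q r (Sinv w)
        + 2 * (w.1 0 : ℂ) * ∑ k ∈ Finset.range (d - r), ν (Sinv w) k * q (r+1+k) (Sinv w) := by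
    intro w hw r h1 h2
    have := hA (Sinv w) (hpos w hw) r h1 h2
    rwa [hSSinv, hainv] at this
  -- the difference identity, given invariance above r
  have hdiff : ∀ r, r < d → (∀ s, r < s → s ≤ d → ∀ w : (ℤ → ℝ) × (ℤ → ℝ), (∀ n, 0 < w.1 n) →
        q s (Sinv w) = q s w ∧ p s w = q s w) →
      ∀ w : (ℤ → ℝ) × (ℤ → ℝ), (∀ n, 0 < w.1 n) →
      (w.2 1 : ℂ) * (A (r+1) (S w) - A (r+1) w) + (w.1 1 : ℂ) ^ 2 * C (r+1) (S w)
        - (w.1 0 : ℂ) ^ 2 * C (r+1) (Sinv w)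
      = 2 * ((w.1 1 : ℂ) * ∑ k ∈ Finset.range (d - r), ν w k * q (r+1+k) w
        - (w.1 0 : ℂ) * ∑ k ∈ Finset.range (d - r), ν (Sinv w) k * q (r+1+k) w) := by
    intro r hr ih w hw
    have core := aux_core (ν w) (ν (Sinv w)) (μ (S w)) (μ (Sinv w)) (fun s => q s w)
      (w.1 1) (w.1 0) (w.2 1) (ν0 _) (ν0 _) (hνrec w) d r
    have hs : ∀ k ∈ Finset.range (d - (r+1)), r < r+1+1+k ∧ r+1+1+k ≤ d := by
      intro k hk; rw [Finset.mem_range] at hk; omega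
    have e1 : ∑ k ∈ Finset.range (d - (r+1)), ν (Sinv w) k * q (r+1+1+k) (Sinv w)
        = ∑ k ∈ Finset.range (d - (r+1)), ν (Sinv w) k * q (r+1+1+k) w :=
      Finset.sum_congr rfl fun k hk => by
        rw [(ih _ (hs k hk).1 (hs k hk).2 w hw).1]
    have e2 : ∑ k ∈ Finset.range (d - (r+1)), p (r+1+1+k) (S w) * μ (S w) k
        = ∑ k ∈ Finset.range (d - (r+1)), q (r+1+1+k) w * μ (S w) k :=
      Finset.sum_congr rfl fun k hk => by
        have h := ih _ (hs k hk).1 (hs k hk).2 (S w) (hposS w hw)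
        rw [h.2, ← h.1, hSinvS]
    have e3 : ∑ k ∈ Finset.range (d - (r+1)), p (r+1+1+k) (Sinv w) * μ (Sinv w) k
        = ∑ k ∈ Finset.range (d - (r+1)), q (r+1+1+k) w * μ (Sinv w) k :=
      Finset.sum_congr rfl fun k hk => by
        rw [(ih _ (hs k hk).1 (hs k hk).2 (Sinv w) (hpos w hw)).2,
          (ih _ (hs k hk).1 (hs k hk).2 w hw).1]
    rw [hA w hw (r+1) (by omega) (by omega), hA' w hw (r+1) (by omega) (by omega),
      hC2 (S w) (hposS w hw) (r+1) (by omega), hC2 (Sinv w) (hpos w hw) (r+1) (by omega),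
      e1, e2, e3, (ih (r+1) (by omega) (by omega) w hw).1, core]
    ring
  have main : ∀ n r, r + n = d → 1 ≤ r → ∀ w : (ℤ → ℝ) × (ℤ → ℝ), (∀ n, 0 < w.1 n) →
        q r (Sinv w) = q r w ∧ p r w = q r w := by
    intro n
    induction n using Nat.strong_induction_on with
    | _ n IH =>
    intro r hrn hr1 w hw
    have ih : ∀ s, r < s → s ≤ d → ∀ w : (ℤ → ℝ) × (ℤ → ℝ), (∀ n, 0 < w.1 n) →
        q s (Sinv w) = q s w ∧ p s w = q s w := fun s h1 h2 =>
      IH (d - s) (by omega) s (by omega) (by omega)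
    have hs : ∀ k ∈ Finset.range (d - r), r < r+1+k ∧ r+1+k ≤ d := by
      intro k hk; rw [Finset.mem_range] at hk; omega
    have e1 : ∑ k ∈ Finset.range (d - r), ν (Sinv w) k * q (r+1+k) (Sinv w)
        = ∑ k ∈ Finset.range (d - r), ν (Sinv w) k * q (r+1+k) w :=
      Finset.sum_congr rfl fun k hk => by
        rw [(ih _ (hs k hk).1 (hs k hk).2 w hw).1]
    have a1 := hA w hw r hr1 (by omega)
    have a2 := hA' w hw r hr1 (by omega)
    rw [e1] at a2
    have h3 := hiii w hw r hr1 (by omega)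
    have c1 := hC w hw (r-1) (by omega)
    rw [Nat.sub_add_cancel hr1] at c1
    have c2 := hC2 w hw r (by omega)
    have core2 := aux_core2 (μ w) (ν w) (ν (Sinv w)) (fun s => p s w) (w.1 1) (w.1 0) (w.2 1)
      (d - r) r (hμrec w)
    have e2 : ∀ f : ℕ → ℂ, ∑ k ∈ Finset.range (d - r), f k * p (r+1+k) w
        = ∑ k ∈ Finset.range (d - r), f k * q (r+1+k) w := fun f =>
      Finset.sum_congr rfl fun k hk => by
        rw [(ih _ (hs k hk).1 (hs k hk).2 w hw).2]
    rw [e2, e2] at core2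
    have hsum : q r w + q r (Sinv w) = 2 * p r w := by
      linear_combination h3 - a1 - a2 + c1 - (w.2 1 : ℂ) * c2 + 2 * core2
    have hdf : q r (Sinv w) = q r w := by
      by_cases hrd : r = d
      · have h4 := hiv w hw
        subst hrd
        simp only [Nat.sub_self, Finset.range_zero, Finset.sum_empty, mul_zero, add_zero] at a1 a2
        rw [← a1, ← a2, h4]
      · have h5 := hdiff r (by omega) ih w hw
        have h6 := hv w hw (r+1) (by omega) (by omega)
        rw [hD w hw (r+1) (by omega), Nat.add_sub_cancel] at h6
        linear_combination a1 - a2 - h6 - h5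
    refine ⟨hdf, ?_⟩
    linear_combination (hdf - hsum) / 2
  intro w hw
  have ih : ∀ s, 0 < s → s ≤ d → ∀ w : (ℤ → ℝ) × (ℤ → ℝ), (∀ n, 0 < w.1 n) →
      q s (Sinv w) = q s w ∧ p s w = q s w := fun s h1 h2 =>
    main (d - s) s (by omega) h1
  have h5 := hdiff 0 (by omega) ih w hw
  have h6 := hvi w hw
  have c2 := hC2 w hw 0 (by omega)
  have core2 := aux_core2 (μ w) (ν w) (ν (Sinv w)) (fun s => q s w) (w.1 1) (w.1 0) (w.2 1)
    (d - 0) 0 (hμrec w)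
  have e1 : ∑ k ∈ Finset.range (d - 0), p (0+1+k) w * μ w k
      = ∑ k ∈ Finset.range (d - 0), q (0+1+k) w * μ w k :=
    Finset.sum_congr rfl fun k hk => by
      rw [Finset.mem_range] at hk
      rw [(ih (0+1+k) (by omega) (by omega) w hw).2]
  rw [e1] at c2
  have g1 : ∑ j ∈ Finset.Icc 1 d, μ w j * q j w
      = ∑ k ∈ Finset.range (d - 0), q (0+1+k) w * μ w (k+1) := by
    rw [aux_Icc, show d + 1 - 1 = d - 0 by omega]
    exact Finset.sum_congr rfl fun k _ => by
      rw [show 0 + 1 + k = 1 + k by omega, show k + 1 = 1 + k by omega, mul_comm]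
  have g2 : ∑ j ∈ Finset.Icc 1 (d-1), ν w j * q (j+1) w
      = ∑ k ∈ Finset.range (d - 0), ν w k * q (0+1+k) w := by
    rw [aux_Icc, show d - 0 = (d - 1 + 1 - 1) + 1 by omega, Finset.sum_range_succ', ν0,
      zero_mul, add_zero]
    exact Finset.sum_congr rfl fun k _ => by
      rw [show 0 + 1 + (k+1) = 1 + k + 1 by omega, show k + 1 = 1 + k by omega]
  rw [g1, g2, core2]
  simp only [Nat.zero_add] at *
  linear_combination (h6 - h5 + (w.2 1 : ℂ) * c2) / 2
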